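/- arXiv:1307.0663 — 10 statements merged into one kernel-verified Lean document; each statement's English description precedes it below -/
import Mathlib

section
/- Let A be a type and app : A → A → Part A a partial applicative structure on A. Then (A, app) admits a combinatory complete filter if and only if (A, app) is a partial combinatory algebra. -/
namespace RealizabilityPaper

variable {A : Type*}

/-- Iterated application `r·x₁·…·xₙ`, associating to the left. -/
def iterApp (app : A → A → Part A) : A → List A → Part A
  | r, [] => Part.some r
  | r, x :: xs => (app r x).bind fun s => iterApp app s xs

/-- A filter on a partial applicative structure `(A, app)`: a set of subsets of `A`
whose members are nonempty, which is upward closed, and closed under images of the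
application operator whenever it is everywhere defined. -/
def IsPasFilter (app : A → A → Part A) (φ : Set (Set A)) : Prop :=
  (∀ U ∈ φ, U.Nonempty) ∧
  (∀ U ∈ φ, ∀ V : Set A, U ⊆ V → V ∈ φ) ∧
  (∀ U ∈ φ, ∀ V ∈ φ, (∀ u ∈ U, ∀ v ∈ V, (app u v).Dom) →
    {w | ∃ u ∈ U, ∃ v ∈ V, w ∈ app u v} ∈ φ)

/-- An `n`-ary partial map `f : Aⁿ → Part A` is `φ`-computable: there is `R ∈ φ` such that
for every `r ∈ R` the applications `r·x₁·…·x_{n-1}` are always defined, and on the domain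
of `f` the application `r·x₁·…·xₙ` is defined and equals `f (x₁,…,xₙ)`. -/
def PhiComputable (app : A → A → Part A) (φ : Set (Set A)) {n : ℕ}
    (f : (Fin n → A) → Part A) : Prop :=
  ∃ R ∈ φ,
    (∀ r ∈ R, ∀ x : Fin (n - 1) → A, (iterApp app r (List.ofFn x)).Dom) ∧
    (∀ r ∈ R, ∀ x : Fin n → A, ∀ v ∈ f x, v ∈ iterApp app r (List.ofFn x))

/-- A filter is combinatory complete if all projections are `φ`-computable and
`φ`-computable partial maps are closed under pointwise application. -/
def CombComplete (app : A → A → Part A) (φ : Set (Set A)) : Prop :=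
  IsPasFilter app φ ∧
  (∀ (n : ℕ) (i : Fin n),
    PhiComputable app φ (fun x : Fin n → A => Part.some (x i))) ∧
  (∀ n : ℕ, 0 < n → ∀ f g : (Fin n → A) → Part A,
    PhiComputable app φ f → PhiComputable app φ g →
    PhiComputable app φ (fun x => (f x).bind fun a => (g x).bind fun b => app a b))

/-- `(A, app)` is a partial combinatory algebra: there are nonempty sets `K` and `S`
of `k`- and `s`-combinators. -/
def IsPCA (app : A → A → Part A) : Prop :=
  ∃ K S : Set A, K.Nonempty ∧ S.Nonempty ∧
    (∀ k ∈ K, ∀ x y : A, x ∈ iterApp app k [x, y]) ∧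
    (∀ s ∈ S, ∀ x y : A, (iterApp app s [x, y]).Dom) ∧
    (∀ s ∈ S, ∀ x y z w : A,
      w ∈ ((app x z).bind fun u => (app y z).bind fun v => app u v) →
      w ∈ iterApp app s [x, y, z])

theorem iterApp_append (app : A → A → Part A) (r : A) (l m : List A) :
    iterApp app r (l ++ m) = (iterApp app r l).bind fun s => iterApp app s m := by
  induction l generalizing r with
  | nil => simp [iterApp]
  | cons x l ih => simp [iterApp, ih, Part.bind_assoc]

theorem iterApp_singleton (app : A → A → Part A) (r x : A) :
    iterApp app r [x] = app r x := by
  simp [iterApp]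

/-- The constant functions of any arity are total and realized. -/
theorem exists_const_realizer {app : A → A → Part A} {k : A}
    (hk : ∀ x y : A, x ∈ iterApp app k [x, y]) (a : A) (n : ℕ) :
    ∃ r, ∀ l : List A, l.length = n → a ∈ iterApp app r l := by
  induction n with
  | zero => exact ⟨a, fun l hl => by simp [List.length_eq_zero_iff.1 hl, iterApp]⟩
  | succ n ih =>
    obtain ⟨r, hr⟩ := ih
    obtain ⟨b, hb, -⟩ := Part.mem_bind_iff.1 (hk r a)
    refine ⟨b, fun l hl => ?_⟩
    obtain ⟨x, l, rfl⟩ := List.exists_cons_of_length_eq_add_one hl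
    obtain ⟨b', hb', h⟩ := Part.mem_bind_iff.1 (hk r x)
    rw [Part.mem_unique hb' hb, iterApp_singleton] at h
    exact Part.mem_bind h (hr l (by simpa using hl))

/-- Realizers of functions that are total on all but the last argument are closed under
pointwise application. -/
theorem exists_pointwise_realizer {app : A → A → Part A} {k s : A}
    (hk : ∀ x y : A, x ∈ iterApp app k [x, y])
    (hs : ∀ x y : A, (iterApp app s [x, y]).Dom)
    (hs' : ∀ x y z w : A,
      w ∈ ((app x z).bind fun u => (app y z).bind fun v => app u v) →
      w ∈ iterApp app s [x, y, z]) (n : ℕ) (f g : A)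
    (hf : ∀ l : List A, l.length = n → (iterApp app f l).Dom)
    (hg : ∀ l : List A, l.length = n → (iterApp app g l).Dom) :
    ∃ h, (∀ l : List A, l.length = n → (iterApp app h l).Dom) ∧
      ∀ l : List A, l.length = n + 1 → ∀ a ∈ iterApp app f l, ∀ b ∈ iterApp app g l,
        ∀ w ∈ app a b, w ∈ iterApp app h l := by
  have key : ∀ x y : A, ∃ c ∈ iterApp app s [x, y], ∀ z, ∀ u ∈ app x z, ∀ v ∈ app y z,
      ∀ w ∈ app u v, w ∈ app c z := by
    intro x y
    obtain ⟨c, hc⟩ := Part.dom_iff_mem.1 (hs x y)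
    refine ⟨c, hc, fun z u hu v hv w hw => ?_⟩
    have h := hs' x y z w (Part.mem_bind hu (Part.mem_bind hv hw))
    rw [show [x, y, z] = [x, y] ++ [z] from rfl, iterApp_append] at h
    obtain ⟨c', hc', h⟩ := Part.mem_bind_iff.1 h
    rwa [Part.mem_unique hc' hc, iterApp_singleton] at h
  induction n generalizing f g with
  | zero =>
    obtain ⟨c, -, hc⟩ := key f g
    refine ⟨c, fun l hl => by simp [List.length_eq_zero_iff.1 hl, iterApp], ?_⟩
    intro l hl a ha b hb w hw
    obtain ⟨x, rfl⟩ := List.length_eq_one_iff.1 hl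
    rw [iterApp_singleton] at ha hb ⊢
    exact hc x a ha b hb w hw
  | succ n ih =>
    have dom_init : ∀ r : A, (∀ l : List A, l.length = n + 1 → (iterApp app r l).Dom) →
        ∀ l : List A, l.length = n → (iterApp app r l).Dom := by
      intro r hr l hl
      have h := hr (l ++ [s]) (by simp [hl])
      rw [iterApp_append] at h
      exact h.1
    obtain ⟨c, hc⟩ := exists_const_realizer hk s (n + 1)
    obtain ⟨p, hp, hp'⟩ := ih c f
      (dom_init c fun l hl => Part.dom_iff_mem.2 ⟨s, hc l hl⟩) (dom_init f hf)
    have hpf : ∀ l : List A, l.length = n + 1 → ∀ a ∈ iterApp app f l, ∀ w ∈ app s a,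
        w ∈ iterApp app p l := fun l hl a ha w hw => hp' l hl s (hc l hl) a ha w hw
    obtain ⟨q, hq, hq'⟩ := ih p g hp (dom_init g hg)
    have hqfg : ∀ l : List A, l.length = n + 1 → ∀ a ∈ iterApp app f l,
        ∀ b ∈ iterApp app g l, ∀ d ∈ iterApp app s [a, b], d ∈ iterApp app q l := by
      intro l hl a ha b hb d hd
      obtain ⟨e, he, hd⟩ := Part.mem_bind_iff.1 hd
      rw [iterApp_singleton] at hd
      exact hq' l hl e (hpf l hl a ha e he) b hb d hd
    refine ⟨q, fun l hl => ?_, fun l hl a ha b hb w hw => ?_⟩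
    · obtain ⟨a, ha⟩ := Part.dom_iff_mem.1 (hf l hl)
      obtain ⟨b, hb⟩ := Part.dom_iff_mem.1 (hg l hl)
      obtain ⟨d, hd⟩ := Part.dom_iff_mem.1 (hs a b)
      exact Part.dom_iff_mem.2 ⟨d, hqfg l hl a ha b hb d hd⟩
    · obtain ⟨m, z, rfl⟩ : ∃ m z, l = m ++ [z] :=
        ⟨l.dropLast, l.getLast (by rintro rfl; simp at hl),
          (List.dropLast_append_getLast _).symm⟩
      have hm : m.length = n + 1 := by simpa using hl
      rw [iterApp_append] at ha hb ⊢
      obtain ⟨a', ha', ha⟩ := Part.mem_bind_iff.1 ha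
      obtain ⟨b', hb', hb⟩ := Part.mem_bind_iff.1 hb
      rw [iterApp_singleton] at ha hb
      obtain ⟨d, hd, hd'⟩ := key a' b'
      refine Part.mem_bind (hqfg m hm a' ha' b' hb' d hd) ?_
      rw [iterApp_singleton]
      exact hd' z a ha b hb w hw

/-- The projection to the first of `n + 1` arguments is realized. -/
theorem exists_head_realizer {app : A → A → Part A} {k s : A}
    (hk : ∀ x y : A, x ∈ iterApp app k [x, y])
    (hs : ∀ x y : A, (iterApp app s [x, y]).Dom)
    (hs' : ∀ x y z w : A,
      w ∈ ((app x z).bind fun u => (app y z).bind fun v => app u v) →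
      w ∈ iterApp app s [x, y, z]) (n : ℕ) :
    ∃ r, ∀ (x : A) (l : List A), l.length = n → x ∈ iterApp app r (x :: l) := by
  have pointwise := fun f g =>
    exists_pointwise_realizer hk hs hs' 0 f g
      (fun l hl => by simp [List.length_eq_zero_iff.1 hl, iterApp])
      (fun l hl => by simp [List.length_eq_zero_iff.1 hl, iterApp])
  have hk' : ∀ x, ∃ c ∈ app k x, ∀ y, x ∈ app c y := by
    intro x
    obtain ⟨c, hc, -⟩ := Part.mem_bind_iff.1 (hk x x)
    refine ⟨c, hc, fun y => ?_⟩
    obtain ⟨c', hc', h⟩ := Part.mem_bind_iff.1 (hk x y)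
    rwa [Part.mem_unique hc' hc, iterApp_singleton] at h
  induction n with
  | zero =>
    obtain ⟨r, -, hr⟩ := pointwise k k
    refine ⟨r, fun x l hl => ?_⟩
    obtain ⟨c, hc, hc'⟩ := hk' x
    rw [List.length_eq_zero_iff.1 hl]
    exact hr [x] rfl c (by rwa [iterApp_singleton]) c (by rwa [iterApp_singleton]) x (hc' c)
  | succ n ih =>
    obtain ⟨r, hr⟩ := ih
    obtain ⟨kk, -, hkk⟩ := hk' k
    obtain ⟨t, -, ht⟩ := pointwise kk r
    refine ⟨t, fun x l hl => ?_⟩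
    obtain ⟨y, l, rfl⟩ := List.exists_cons_of_length_eq_add_one hl
    obtain ⟨a, ha, hx⟩ := Part.mem_bind_iff.1 (hr x l (by simpa using hl))
    obtain ⟨c, hc, hc'⟩ := hk' a
    have h := ht [x] rfl k (by rw [iterApp_singleton]; exact hkk x) a
      (by rwa [iterApp_singleton]) c hc
    rw [iterApp_singleton] at h
    exact Part.mem_bind h (Part.mem_bind (hc' y) hx)

/-- All projections are realized. -/
theorem exists_proj_realizer {app : A → A → Part A} {k s : A}
    (hk : ∀ x y : A, x ∈ iterApp app k [x, y])
    (hs : ∀ x y : A, (iterApp app s [x, y]).Dom)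
    (hs' : ∀ x y z w : A,
      w ∈ ((app x z).bind fun u => (app y z).bind fun v => app u v) →
      w ∈ iterApp app s [x, y, z]) (n : ℕ) (i : Fin n) :
    ∃ r, ∀ x : Fin n → A, x i ∈ iterApp app r (List.ofFn x) := by
  induction n with
  | zero => exact i.elim0
  | succ n ih =>
    cases i using Fin.cases with
    | zero =>
      obtain ⟨r, hr⟩ := exists_head_realizer hk hs hs' n
      refine ⟨r, fun x => ?_⟩
      rw [List.ofFn_succ]
      exact hr _ _ (by simp)
    | succ i =>
      obtain ⟨r, hr⟩ := ih i
      obtain ⟨c, hc⟩ := exists_const_realizer hk r 1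
      refine ⟨c, fun x => ?_⟩
      rw [List.ofFn_succ, ← List.singleton_append, iterApp_append]
      exact Part.mem_bind (hc _ rfl) (hr _)

theorem exists_ofFn_eq {n : ℕ} {l : List A} (hl : l.length = n) :
    ∃ x : Fin n → A, List.ofFn x = l := by
  subst hl
  exact ⟨l.get, List.ofFn_get l⟩

/-- The set of all nonempty subsets is a filter on any partial applicative structure. -/
theorem isPasFilter_nonempty (app : A → A → Part A) :
    IsPasFilter app {U | U.Nonempty} := by
  refine ⟨fun U hU => hU, fun U hU V h => Set.Nonempty.mono h hU, ?_⟩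
  rintro U ⟨u, hu⟩ V ⟨v, hv⟩ h
  exact ⟨_, u, hu, v, hv, Part.get_mem (h u hu v hv)⟩

theorem CombComplete.isPCA {app : A → A → Part A} {φ : Set (Set A)}
    (h : CombComplete app φ) : IsPCA app := by
  obtain ⟨⟨hne, -, -⟩, hproj, happ⟩ := h
  obtain ⟨K, hK, -, hK'⟩ := hproj 2 0
  obtain ⟨S, hS, hSdom, hS'⟩ := happ 3 (by norm_num) _ _
    (happ 3 (by norm_num) _ _ (hproj 3 0) (hproj 3 2))
    (happ 3 (by norm_num) _ _ (hproj 3 1) (hproj 3 2))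
  refine ⟨K, S, hne K hK, hne S hS, fun k hk x y => ?_, fun s hs x y => ?_,
    fun s hs x y z w hw => ?_⟩
  · simpa using hK' k hk ![x, y] x (by simp)
  · simpa using hSdom s hs ![x, y]
  · simpa using hS' s hs ![x, y, z] w (by simpa using hw)

theorem IsPCA.combComplete_nonempty {app : A → A → Part A} (h : IsPCA app) :
    CombComplete app {U | U.Nonempty} := by
  obtain ⟨K, S, ⟨k, hk⟩, ⟨s, hs⟩, hK, hSdom, hS⟩ := h
  refine ⟨isPasFilter_nonempty app, fun n i => ?_, fun n hn f g => ?_⟩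
  · obtain ⟨r, hr⟩ := exists_proj_realizer (hK k hk) (hSdom s hs) (hS s hs) n i
    refine ⟨{r}, ⟨r, rfl⟩, ?_, ?_⟩
    · rintro _ rfl x
      obtain ⟨n, rfl⟩ : ∃ m, n = m + 1 := ⟨n - 1, by have := i.pos; omega⟩
      have h := Part.dom_iff_mem.2 ⟨_, hr (Fin.snoc (α := fun _ => A) x k)⟩
      rw [List.ofFn_succ', List.concat_eq_append, iterApp_append] at h
      simpa using h.1
    · rintro _ rfl x v hv
      rw [Part.mem_some_iff.1 hv]
      exact hr x
  · rintro ⟨F, hF, hFdom, hF'⟩ ⟨G, hG, hGdom, hG'⟩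
    obtain ⟨a, ha⟩ := hF
    obtain ⟨b, hb⟩ := hG
    obtain ⟨r, hr, hr'⟩ := exists_pointwise_realizer (hK k hk) (hSdom s hs) (hS s hs) (n - 1) a b
      (fun l hl => by obtain ⟨x, rfl⟩ := exists_ofFn_eq hl; exact hFdom a ha x)
      (fun l hl => by obtain ⟨x, rfl⟩ := exists_ofFn_eq hl; exact hGdom b hb x)
    refine ⟨{r}, ⟨r, rfl⟩, ?_, ?_⟩
    · rintro _ rfl x
      exact hr _ (by simp)
    · rintro _ rfl x v hv
      obtain ⟨u, hu, hv⟩ := Part.mem_bind_iff.1 hv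
      obtain ⟨w, hw, hv⟩ := Part.mem_bind_iff.1 hv
      exact hr' _ (by simp; omega) u (hF' a ha x u hu) w (hG' b hb x w hw) v hv

/-- A partial applicative structure admits a combinatory complete filter
if and only if it is a partial combinatory algebra. -/
theorem exists_combComplete_filter_iff_isPCA (app : A → A → Part A) :
    (∃ φ : Set (Set A), CombComplete app φ) ↔ IsPCA app :=
  ⟨fun ⟨_, h⟩ => h.isPCA, fun h => ⟨_, h.combComplete_nonempty⟩⟩

end RealizabilityPaper
end

section
/- If a partial applicative structure (A, app) is a partial combinatory algebra, then the set of all nonempty subsets of A is a combinatory complete filter on (A, app). -/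
namespace RealizabilityPaper

variable {A : Type*}

/-- The polynomial partial maps `Aⁿ → Part A`: those built from the coordinates and the
constants by pointwise application. -/
inductive IsPolynomial (app : A → A → Part A) {n : ℕ} : ((Fin n → A) → Part A) → Prop
  | proj (i : Fin n) : IsPolynomial app fun x => Part.some (x i)
  | const (a : A) : IsPolynomial app fun _ => Part.some a
  | comp {f g : (Fin n → A) → Part A} (hf : IsPolynomial app f) (hg : IsPolynomial app g) :
      IsPolynomial app fun x => (f x).bind fun a => (g x).bind fun b => app a b

theorem mem_iterApp_ofFn_succ {app : A → A → Part A} {r : A} {n : ℕ} {x : Fin (n + 1) → A}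
    {v : A} : v ∈ iterApp app r (List.ofFn x) ↔
      ∃ u ∈ iterApp app r (List.ofFn (Fin.init x)), v ∈ app u (x (Fin.last n)) := by
  rw [List.ofFn_succ', List.concat_eq_append, iterApp_append]
  simp [iterApp, Fin.init_def]

/-- Iterated application of a polynomial map to a list of coordinates is polynomial. -/
theorem IsPolynomial.iterApp {app : A → A → Part A} {n : ℕ} {f : (Fin n → A) → Part A}
    (hf : IsPolynomial app f) (l : List (Fin n)) :
    IsPolynomial app fun x => (f x).bind fun s => iterApp app s (l.map x) := by
  induction l generalizing f with
  | nil => simpa [RealizabilityPaper.iterApp] using hf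
  | cons i l ih =>
    simpa [RealizabilityPaper.iterApp, Part.bind_assoc] using ih (hf.comp (.proj i))

theorem isPolynomial_iterApp_ofFn (app : A → A → Part A) (r : A) (n : ℕ) :
    IsPolynomial app fun x : Fin n → A => iterApp app r (List.ofFn x) := by
  simpa [List.ofFn_eq_map] using (IsPolynomial.const r).iterApp (List.finRange n)

/-- Abstraction of the last variable of a polynomial map in a partial combinatory algebra. -/
theorem IsPolynomial.exists_abstraction {app : A → A → Part A} (h : IsPCA app) {n : ℕ}
    {f : (Fin (n + 1) → A) → Part A} (hf : IsPolynomial app f) :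
    ∃ g : (Fin n → A) → Part A, IsPolynomial app g ∧ (∀ x, (g x).Dom) ∧
      ∀ x, ∀ v ∈ f x, ∃ u ∈ g (Fin.init x), v ∈ app u (x (Fin.last n)) := by
  obtain ⟨K, S, ⟨k, hkK⟩, ⟨s, hsS⟩, hK, hSdom, hS⟩ := h
  have hk : ∀ x y, ∃ u ∈ app k x, x ∈ app u y := fun x y => by
    simpa [RealizabilityPaper.iterApp] using hK k hkK x y
  have hk_dom : ∀ x, (app k x).Dom := fun x =>
    let ⟨_, hu, _⟩ := hk x x
    Part.dom_iff_mem.2 ⟨_, hu⟩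
  have hs_dom : ∀ x y, ∃ w, ∃ u ∈ app s x, w ∈ app u y := fun x y => by
    simpa [RealizabilityPaper.iterApp, Part.dom_iff_mem] using hSdom s hsS x y
  have hs : ∀ x y z u v w, u ∈ app x z → v ∈ app y z → w ∈ app u v →
      ∃ p ∈ app s x, ∃ q ∈ app p y, w ∈ app q z := fun x y z u v w hu hv hw => by
    simpa [RealizabilityPaper.iterApp] using hS s hsS x y z w
      (Part.mem_bind hu (Part.mem_bind hv hw))
  induction hf with
  | proj i =>
    induction i using Fin.lastCases with
    | last =>
      obtain ⟨e, p, hp, he⟩ := hs_dom k k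
      refine ⟨_, .const e, fun _ => trivial, fun x v hv => ⟨e, Part.mem_some e, ?_⟩⟩
      obtain rfl := Part.mem_some_iff.1 hv
      obtain ⟨u, hu, -⟩ := hk (x (Fin.last n)) k
      obtain ⟨u', hu', hv'⟩ := hk (x (Fin.last n)) u
      obtain rfl := Part.mem_unique hu hu'
      obtain ⟨p', hp', q, hq, hw⟩ := hs k k _ _ _ _ hu hu hv'
      obtain rfl := Part.mem_unique hp hp'
      obtain rfl := Part.mem_unique he hq
      exact hw
    | cast j =>
      refine ⟨_, (IsPolynomial.const k).comp (.proj j), fun x => by simpa using hk_dom (x j),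
        fun x v hv => ?_⟩
      obtain rfl := Part.mem_some_iff.1 hv
      simpa [Fin.init_def] using hk (x j.castSucc) (x (Fin.last n))
  | const a =>
    refine ⟨_, (IsPolynomial.const k).comp (.const a), fun x => by simpa using hk_dom a,
      fun x v hv => ?_⟩
    obtain rfl := Part.mem_some_iff.1 hv
    simpa using hk v (x (Fin.last n))
  | comp _ _ ihf ihg =>
    obtain ⟨F, hF, hFdom, hFv⟩ := ihf
    obtain ⟨G, hG, hGdom, hGv⟩ := ihg
    refine ⟨_, ((IsPolynomial.const s).comp hF).comp hG, fun x => ?_, fun x v hv => ?_⟩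
    · obtain ⟨w, u, hu, hw⟩ := hs_dom ((F x).get (hFdom x)) ((G x).get (hGdom x))
      exact Part.dom_iff_mem.2 ⟨w, Part.mem_bind
        (Part.mem_bind (Part.mem_some s) (Part.mem_bind (Part.get_mem _) hu))
        (Part.mem_bind (Part.get_mem _) hw)⟩
    · obtain ⟨a, ha, b, hb, hv⟩ := by simpa only [Part.mem_bind_iff] using hv
      obtain ⟨a', ha', haa⟩ := hFv x a ha
      obtain ⟨b', hb', hbb⟩ := hGv x b hb
      obtain ⟨p, hp, q, hq, hw⟩ := hs _ _ _ _ _ _ haa hbb hv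
      exact ⟨q, Part.mem_bind (Part.mem_bind (Part.mem_some s) (Part.mem_bind ha' hp))
        (Part.mem_bind hb' hq), hw⟩

/-- In a partial combinatory algebra every polynomial map of positive arity is represented
by an element. -/
theorem IsPolynomial.exists_representative {app : A → A → Part A} (h : IsPCA app) {n : ℕ}
    {f : (Fin (n + 1) → A) → Part A} (hf : IsPolynomial app f) :
    ∃ r : A, (∀ x : Fin n → A, (RealizabilityPaper.iterApp app r (List.ofFn x)).Dom) ∧
      ∀ x, ∀ v ∈ f x, v ∈ RealizabilityPaper.iterApp app r (List.ofFn x) := by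
  obtain ⟨g, hg, hgdom, hgv⟩ := hf.exists_abstraction h
  suffices H : ∃ r : A, ∀ x, ∀ v ∈ g x, v ∈ RealizabilityPaper.iterApp app r (List.ofFn x) by
    obtain ⟨r, hr⟩ := H
    refine ⟨r, fun x => Part.dom_iff_mem.2 ⟨_, hr x _ (Part.get_mem (hgdom x))⟩,
      fun x v hv => ?_⟩
    obtain ⟨u, hu, hv⟩ := hgv x v hv
    exact mem_iterApp_ofFn_succ.2 ⟨u, hr _ u hu, hv⟩
  clear hgv
  cases n with
  | zero =>
    refine ⟨(g ![]).get (hgdom _), fun x v hv => ?_⟩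
    obtain rfl := Subsingleton.elim x ![]
    simpa [RealizabilityPaper.iterApp] using hv
  | succ n =>
    obtain ⟨r, -, hr⟩ := hg.exists_representative h
    exact ⟨r, hr⟩

theorem IsPolynomial.phiComputable {app : A → A → Part A} (h : IsPCA app) {n : ℕ} (hn : 0 < n)
    {f g : (Fin n → A) → Part A} (hg : IsPolynomial app g) (hfg : ∀ x, ∀ v ∈ f x, v ∈ g x) :
    PhiComputable app {U : Set A | U.Nonempty} f := by
  obtain ⟨n, rfl⟩ := Nat.exists_eq_add_one_of_ne_zero hn.ne'
  obtain ⟨r, hrdom, hr⟩ := hg.exists_representative h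
  refine ⟨{r}, Set.singleton_nonempty r, ?_, ?_⟩
  · rintro _ rfl x
    exact hrdom x
  · rintro _ rfl x v hv
    exact hr x v (hfg x v hv)

/-- If `(A, app)` is a partial combinatory algebra, then the set of all nonempty
subsets of `A` is a combinatory complete filter. -/
theorem combComplete_nonempty_of_isPCA (app : A → A → Part A) (h : IsPCA app) :
    CombComplete app {U : Set A | U.Nonempty} := by
  refine ⟨⟨fun _ hU => hU, fun _ hU _ hUV => hU.mono hUV, ?_⟩, fun n i => ?_, ?_⟩
  · rintro U ⟨u, hu⟩ V ⟨v, hv⟩ hdom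
    exact ⟨_, u, hu, v, hv, Part.get_mem (hdom u hu v hv)⟩
  · exact (IsPolynomial.proj i).phiComputable h i.pos fun _ _ hv => hv
  · rintro n hn f g ⟨R, ⟨r, hr⟩, -, hf⟩ ⟨T, ⟨t, ht⟩, -, hg⟩
    refine ((isPolynomial_iterApp_ofFn app r n).comp
      (isPolynomial_iterApp_ofFn app t n)).phiComputable h hn fun x v hv => ?_
    obtain ⟨a, ha, b, hb, hv⟩ := by simpa only [Part.mem_bind_iff] using hv
    exact Part.mem_bind (hf r hr x a ha) (Part.mem_bind (hg t ht x b hb) hv)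

end RealizabilityPaper
end

section
/- For Kleene application on ℕ there exist k, s ∈ ℕ such that: for all x, y ∈ ℕ, app k x is defined, app (app k x) y is defined and equals x; for all x, y ∈ ℕ, app s x and app (app s x) y are defined; and for all x, y, z ∈ ℕ, if app (app x z) (app y z) is defined then app (app (app s x) y) z is defined and equals it (all intermediate applications being defined). In particular, (ℕ, app) is a partial combinatory algebra. -/
namespace RealizabilityPaper

variable {A : Type*}

/-- Kleene application on `ℕ` via Mathlib's codes for partial recursive functions. -/
def kleeneApp (n m : ℕ) : Part ℕ :=
  Nat.Partrec.Code.eval (Denumerable.ofNat Nat.Partrec.Code n) m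

/-- Kleene application is partial recursive as a function of both arguments. -/
theorem partrec₂_kleeneApp : Partrec₂ kleeneApp :=
  Nat.Partrec.Code.eval_part.comp ((Computable.ofNat _).comp Computable.fst) Computable.snd

/-- Indices for a parametrised family of partial recursive functions can be computed
from the parameter. -/
theorem exists_computable_index {α : Type*} [Primcodable α] {f : α → ℕ →. ℕ}
    (hf : Partrec₂ f) :
    ∃ g : α → ℕ, Computable g ∧ ∀ a m, kleeneApp (g a) m = f a m := by
  obtain ⟨c, hc⟩ := Nat.Partrec.Code.exists_code.1 hf
  refine ⟨fun a => Encodable.encode (Nat.Partrec.Code.curry c (Encodable.encode a)),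
    (Primrec.encode.comp
      (Nat.Partrec.Code.primrec₂_curry.comp (Primrec.const c) Primrec.encode)).to_comp,
    fun a m => ?_⟩
  have h := congrFun hc (Encodable.encode (a, m))
  simpa [kleeneApp, Nat.Partrec.Code.eval_curry, Part.map_id'] using h

/-- Every computable function on `ℕ` has an index. -/
theorem exists_index {g : ℕ → ℕ} (hg : Computable g) :
    ∃ e : ℕ, ∀ m, kleeneApp e m = Part.some (g m) := by
  obtain ⟨h, -, hh⟩ := exists_computable_index (α := Unit) (hg.comp Computable.snd).partrec.to₂
  exact ⟨h (), hh ()⟩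

/-- Two-argument partial recursive functions are represented in curried form. -/
theorem exists_index₂ {f : ℕ → ℕ →. ℕ} (hf : Partrec₂ f) :
    ∃ e : ℕ, ∀ x, ∃ u, kleeneApp e x = Part.some u ∧ ∀ y, kleeneApp u y = f x y := by
  obtain ⟨g, hg, hgf⟩ := exists_computable_index hf
  obtain ⟨e, he⟩ := exists_index hg
  exact ⟨e, fun x => ⟨g x, he x, hgf x⟩⟩

/-- Three-argument partial recursive functions are represented in curried form. -/
theorem exists_index₃ {f : ℕ × ℕ → ℕ →. ℕ} (hf : Partrec₂ f) :
    ∃ e : ℕ, ∀ x, ∃ u, kleeneApp e x = Part.some u ∧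
      ∀ y, ∃ v, kleeneApp u y = Part.some v ∧ ∀ z, kleeneApp v z = f (x, y) z := by
  obtain ⟨g, hg, hgf⟩ := exists_computable_index hf
  obtain ⟨e, he⟩ := exists_index₂ (f := fun x y => Part.some (g (x, y))) hg.partrec.to₂
  refine ⟨e, fun x => ?_⟩
  obtain ⟨u, hu, huy⟩ := he x
  exact ⟨u, hu, fun y => ⟨g (x, y), huy y, hgf (x, y)⟩⟩

/-- The body of the `s` combinator is partial recursive. -/
theorem partrec₂_sBody :
    Partrec₂ fun (p : ℕ × ℕ) (z : ℕ) =>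
      (kleeneApp p.1 z).bind fun u => (kleeneApp p.2 z).bind fun v => kleeneApp u v := by
  have hx : Partrec fun q : (ℕ × ℕ) × ℕ => kleeneApp q.1.1 q.2 :=
    partrec₂_kleeneApp.comp (Computable.fst.comp Computable.fst) Computable.snd
  have hy : Partrec fun q : ((ℕ × ℕ) × ℕ) × ℕ => kleeneApp q.1.1.2 q.1.2 :=
    partrec₂_kleeneApp.comp
      (Computable.snd.comp (Computable.fst.comp Computable.fst))
      (Computable.snd.comp Computable.fst)
  have huv : Partrec fun r : (((ℕ × ℕ) × ℕ) × ℕ) × ℕ => kleeneApp r.1.2 r.2 :=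
    partrec₂_kleeneApp.comp (Computable.snd.comp Computable.fst) Computable.snd
  exact hx.bind (hy.bind huv.to₂).to₂

/-- There are `k` and `s` combinators for Kleene application; in particular
`(ℕ, kleeneApp)` is a partial combinatory algebra. -/
theorem kleeneApp_isPCA :
    (∃ k s : ℕ,
      (∀ x y : ℕ, x ∈ iterApp kleeneApp k [x, y]) ∧
      (∀ x y : ℕ, (iterApp kleeneApp s [x, y]).Dom) ∧
      (∀ x y z w : ℕ,
        w ∈ ((kleeneApp x z).bind fun u => (kleeneApp y z).bind fun v => kleeneApp u v) →
        w ∈ iterApp kleeneApp s [x, y, z])) ∧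
    IsPCA kleeneApp := by
  obtain ⟨k, hk⟩ := exists_index₂ (f := fun x _ => Part.some x) Computable.fst.partrec.to₂
  obtain ⟨s, hs⟩ := exists_index₃ partrec₂_sBody
  have hkk : ∀ x y : ℕ, x ∈ iterApp kleeneApp k [x, y] := by
    intro x y
    obtain ⟨u, hu, huy⟩ := hk x
    simp [iterApp, hu, huy]
  have hsd : ∀ x y : ℕ, (iterApp kleeneApp s [x, y]).Dom := by
    intro x y
    obtain ⟨u, hu, huy⟩ := hs x
    obtain ⟨v, hv, -⟩ := huy y
    simp [iterApp, hu, hv]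
  have hss : ∀ x y z w : ℕ,
      w ∈ ((kleeneApp x z).bind fun u => (kleeneApp y z).bind fun v => kleeneApp u v) →
      w ∈ iterApp kleeneApp s [x, y, z] := by
    intro x y z w hw
    obtain ⟨u, hu, huy⟩ := hs x
    obtain ⟨v, hv, hvz⟩ := huy y
    simpa [iterApp, hu, hv, hvz] using hw
  refine ⟨⟨k, s, hkk, hsd, hss⟩, {k}, {s}, Set.singleton_nonempty k, Set.singleton_nonempty s,
    ?_, ?_, ?_⟩
  · rintro _ rfl
    exact hkk
  · rintro _ rfl
    exact hsd
  · rintro _ rfl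
    exact hss

end RealizabilityPaper
end

section
/- Let (A, app) be a partial applicative structure, φ a combinatory complete filter on it, and X a type. Then the realizability relation ⊨ on subsets of A × X is reflexive and transitive, i.e., a preorder. -/
namespace RealizabilityPaper

variable {A : Type*}

/-- `h(U, V) = {a | ∀ (b, x) ∈ U, a·b is defined and (a·b, x) ∈ V}`. -/
def hSet (app : A → A → Part A) {X : Type*} (U V : Set (A × X)) : Set A :=
  {a | ∀ b : A, ∀ x : X, (b, x) ∈ U → ∃ c ∈ app a b, (c, x) ∈ V}

/-- The realizability preorder `U ⊨ V` on subsets of `A × X`: `h(U, V) ∈ φ`. -/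
def rleq (app : A → A → Part A) (φ : Set (Set A)) {X : Type*}
    (U V : Set (A × X)) : Prop :=
  hSet app U V ∈ φ

/-- If every element of `R` applies totally to two arguments, then applying `R` to two members
of the filter gives a member of the filter. -/
theorem IsPasFilter.image₂_mem {app : A → A → Part A} {φ : Set (Set A)} (hφ : IsPasFilter app φ)
    {R U V : Set A} (hR : R ∈ φ) (hU : U ∈ φ) (hV : V ∈ φ)
    (hdom : ∀ r ∈ R, ∀ u v : A, (iterApp app r [u, v]).Dom) :
    {w | ∃ r ∈ R, ∃ u ∈ U, ∃ v ∈ V, w ∈ iterApp app r [u, v]} ∈ φ := by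
  obtain ⟨-, hup, happ⟩ := hφ
  have hS := happ R hR U hU fun r hr u _ => (hdom r hr u u).1
  have hT := happ _ hS V hV (by
    rintro s ⟨r, hr, u, -, hs⟩ v -
    obtain ⟨w, hw⟩ := Part.dom_iff_mem.1 (hdom r hr u v)
    simp only [iterApp, Part.mem_bind_iff, Part.mem_some_iff] at hw
    obtain ⟨s', hs', t, ht, -⟩ := hw
    rw [Part.mem_unique hs hs']
    exact Part.dom_iff_mem.2 ⟨t, ht⟩)
  refine hup _ hT _ ?_
  rintro w ⟨s, ⟨r, hr, u, hu, hs⟩, v, hv, hw⟩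
  refine ⟨r, hr, u, hu, v, hv, ?_⟩
  simp only [iterApp, Part.mem_bind_iff, Part.mem_some_iff]
  exact ⟨s, hs, w, hw, rfl⟩

/-- The realizability relation `⊨` on subsets of `A × X` is reflexive and transitive. -/
theorem rleq_isPreorder (app : A → A → Part A) (φ : Set (Set A))
    (h : CombComplete app φ) (X : Type*) :
    (∀ U : Set (A × X), rleq app φ U U) ∧
    (∀ U V W : Set (A × X), rleq app φ U V → rleq app φ V W → rleq app φ U W) := by
  obtain ⟨hφ, hproj, hcomp⟩ := h
  refine ⟨fun U => ?_, fun U V W hUV hVW => ?_⟩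
  · obtain ⟨R, hR, -, hval⟩ := hproj 1 0
    refine hφ.2.1 R hR _ fun r hr b x hb => ⟨b, ?_, hb⟩
    simpa [iterApp] using hval r hr ![b] b (by simp)
  · obtain ⟨R, hR, hdom, hval⟩ := hcomp 3 (by norm_num) _ _ (hproj 3 1)
      (hcomp 3 (by norm_num) _ _ (hproj 3 0) (hproj 3 2))
    refine hφ.2.1 _ (hφ.image₂_mem hR hUV hVW
      fun r hr u v => by simpa using hdom r hr ![u, v]) _ ?_
    rintro w ⟨r, hr, u, hu, v, hv, hw⟩ b x hb
    obtain ⟨c, hc, hcV⟩ := hu b x hb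
    obtain ⟨d, hd, hdW⟩ := hv c x hcV
    refine ⟨d, ?_, hdW⟩
    have hd' := hval r hr ![u, v, b] d (by
      simp only [Part.bind_some, Part.mem_bind_iff]
      exact ⟨c, hc, hd⟩)
    simp only [List.ofFn_succ, List.ofFn_zero, iterApp, Part.mem_bind_iff,
      Part.mem_some_iff] at hd' hw
    obtain ⟨s, hs, t, ht, e, he, rfl⟩ := hd'
    obtain ⟨s', hs', t', ht', rfl⟩ := hw
    obtain rfl := Part.mem_unique hs' hs
    obtain rfl := Part.mem_unique ht' ht
    exact he

end RealizabilityPaper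
end

section
/- Let (A, app) be a partial applicative structure, φ a combinatory complete filter on it, and X a type. There exists a binary operation ⊗ on subsets of A × X such that for all U, V, W ⊆ A × X: U ⊗ V ⊨ U, U ⊗ V ⊨ V, and if W ⊨ U and W ⊨ V then W ⊨ U ⊗ V. That is, the preorder (P(A × X), ⊨) has binary meets. -/
namespace RealizabilityPaper

variable {A : Type*}

theorem mem_iterApp_nil {app : A → A → Part A} {r v : A} :
    v ∈ iterApp app r [] ↔ v = r := by
  simp [iterApp]

theorem mem_iterApp_cons {app : A → A → Part A} {r x v : A} {xs : List A} :
    v ∈ iterApp app r (x :: xs) ↔ ∃ s ∈ app r x, v ∈ iterApp app s xs := by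
  simp [iterApp]

/-- Some member of `φ` consists of realizers `r` of the flipped application
`r·y·p = p·y`. -/
theorem CombComplete.exists_flip {app : A → A → Part A} {φ : Set (Set A)}
    (h : CombComplete app φ) :
    ∃ R ∈ φ, ∀ r ∈ R, ∀ y : A, ∃ s ∈ app r y, ∀ p : A, ∀ v ∈ app p y, v ∈ app s p := by
  obtain ⟨-, hproj, happ⟩ := h
  obtain ⟨R, hR, hdom, hval⟩ := happ 2 (by norm_num) _ _ (hproj 2 1) (hproj 2 0)
  refine ⟨R, hR, fun r hr y => ?_⟩
  have hd := Part.dom_iff_mem.1 (hdom r hr ![y])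
  simp only [List.ofFn_succ, List.ofFn_zero, mem_iterApp_cons] at hd
  obtain ⟨-, s, hs, -⟩ := hd
  refine ⟨s, hs, fun p v hv => ?_⟩
  have hv' := hval r hr ![y, p] v (by simpa using hv)
  simp only [List.ofFn_succ, List.ofFn_zero, mem_iterApp_cons, mem_iterApp_nil] at hv'
  obtain ⟨s', hs', t, ht, rfl⟩ := hv'
  obtain rfl := Part.mem_unique hs hs'
  exact ht

/-- Some member of `φ` consists of realizers `r` of
`r·u·v·b·z = z·(u·b)·(v·b)`. -/
theorem CombComplete.exists_pairing {app : A → A → Part A} {φ : Set (Set A)}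
    (h : CombComplete app φ) :
    ∃ R ∈ φ, ∀ r ∈ R, ∀ u : A, ∃ s ∈ app r u, ∀ v : A, ∃ t ∈ app s v, ∀ b : A,
      ∃ p ∈ app t b, ∀ z : A, ∀ c ∈ app u b, ∀ d ∈ app v b,
        ∀ w ∈ iterApp app z [c, d], w ∈ app p z := by
  obtain ⟨-, hproj, happ⟩ := h
  have h4 : 0 < 4 := by norm_num
  obtain ⟨R, hR, hdom, hval⟩ := happ 4 h4 _ _
    (happ 4 h4 _ _ (hproj 4 3) (happ 4 h4 _ _ (hproj 4 0) (hproj 4 2)))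
    (happ 4 h4 _ _ (hproj 4 1) (hproj 4 2))
  have key : ∀ r ∈ R, ∀ u v b : A, ∃ s ∈ app r u, ∃ t ∈ app s v, ∃ p, p ∈ app t b := by
    intro r hr u v b
    have hd := Part.dom_iff_mem.1 (hdom r hr ![u, v, b])
    simp only [List.ofFn_succ, List.ofFn_zero, mem_iterApp_cons] at hd
    obtain ⟨-, s, hs, t, ht, p, hp, -⟩ := hd
    exact ⟨s, hs, t, ht, p, hp⟩
  refine ⟨R, hR, fun r hr u => ?_⟩
  obtain ⟨s, hs, -⟩ := key r hr u u u
  refine ⟨s, hs, fun v => ?_⟩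
  obtain ⟨s', hs', t, ht, -⟩ := key r hr u v u
  obtain rfl := Part.mem_unique hs hs'
  refine ⟨t, ht, fun b => ?_⟩
  obtain ⟨s', hs', t', ht', p, hp⟩ := key r hr u v b
  obtain rfl := Part.mem_unique hs hs'
  obtain rfl := Part.mem_unique ht ht'
  refine ⟨p, hp, fun z c hc d hd w hw => ?_⟩
  simp only [mem_iterApp_cons, mem_iterApp_nil] at hw
  obtain ⟨e, he, w', hw', rfl⟩ := hw
  have hv' := hval r hr ![u, v, b, z] w (by
    simp only [Part.mem_bind_iff, Part.mem_some_iff]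
    exact ⟨e, ⟨z, rfl, c, ⟨u, rfl, b, rfl, hc⟩, he⟩, d, ⟨v, rfl, b, rfl, hd⟩, hw'⟩)
  simp only [List.ofFn_succ, List.ofFn_zero, mem_iterApp_cons, mem_iterApp_nil] at hv'
  obtain ⟨s', hs', t', ht', p', hp', w', hmem, rfl⟩ := hv'
  obtain rfl := Part.mem_unique hs hs'
  obtain rfl := Part.mem_unique ht ht'
  obtain rfl := Part.mem_unique hp hp'
  exact hmem

/-- Some member of `φ` consists of realizers of the `i`-th binary projection. -/
theorem CombComplete.exists_proj {app : A → A → Part A} {φ : Set (Set A)}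
    (h : CombComplete app φ) (i : Fin 2) :
    ∃ K ∈ φ, ∀ k ∈ K, ∀ c d : A, ![c, d] i ∈ iterApp app k [c, d] := by
  obtain ⟨K, hK, -, hval⟩ := h.2.1 2 i
  refine ⟨K, hK, fun k hk c d => ?_⟩
  simpa using hval k hk ![c, d] _ (Part.mem_some _)

/-- If all elements of `K ∈ φ`, used as arguments, send `M` into `U`, then `M ⊨ U`. -/
theorem CombComplete.rleq_of_forall_app {app : A → A → Part A} {φ : Set (Set A)}
    (h : CombComplete app φ) {X : Type*} {M U : Set (A × X)} {K : Set A} (hK : K ∈ φ)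
    (hMU : ∀ k ∈ K, ∀ p x, (p, x) ∈ M → ∃ c ∈ app p k, (c, x) ∈ U) : rleq app φ M U := by
  obtain ⟨R, hR, hflip⟩ := h.exists_flip
  have happ := h.1.2.2 R hR K hK fun r hr k _ =>
    let ⟨s, hs, _⟩ := hflip r hr k
    Part.dom_iff_mem.2 ⟨s, hs⟩
  refine h.1.2.1 _ happ _ ?_
  rintro w ⟨r, hr, k, hk, hw⟩ p x hp
  obtain ⟨s, hs, hval⟩ := hflip r hr k
  obtain rfl := Part.mem_unique hw hs
  obtain ⟨c, hc, hcU⟩ := hMU k hk p x hp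
  exact ⟨c, hval p c hc, hcU⟩

/-- The preorder `(P(A × X), ⊨)` has binary meets. -/
theorem rleq_has_binary_meets (app : A → A → Part A) (φ : Set (Set A))
    (h : CombComplete app φ) (X : Type*) :
    ∃ mee : Set (A × X) → Set (A × X) → Set (A × X),
      ∀ U V W : Set (A × X),
        rleq app φ (mee U V) U ∧ rleq app φ (mee U V) V ∧
        (rleq app φ W U → rleq app φ W V → rleq app φ W (mee U V)) := by
  obtain ⟨K, hK, hfst⟩ := h.exists_proj 0
  obtain ⟨L, hL, hsnd⟩ := h.exists_proj 1
  refine ⟨fun U V => {q | (∀ k ∈ K, ∃ c ∈ app q.1 k, (c, q.2) ∈ U) ∧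
    ∀ l ∈ L, ∃ c ∈ app q.1 l, (c, q.2) ∈ V}, fun U V W => ⟨?_, ?_, fun hWU hWV => ?_⟩⟩
  · exact h.rleq_of_forall_app hK fun k hk p x hp => hp.1 k hk
  · exact h.rleq_of_forall_app hL fun l hl p x hp => hp.2 l hl
  obtain ⟨R, hR, hpair⟩ := h.exists_pairing
  have hRU := h.1.2.2 R hR _ hWU fun r hr u _ =>
    let ⟨s, hs, _⟩ := hpair r hr u
    Part.dom_iff_mem.2 ⟨s, hs⟩
  have hRUV := h.1.2.2 _ hRU _ hWV (by
    rintro s ⟨r, hr, u, -, hs⟩ v -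
    obtain ⟨s', hs', hs''⟩ := hpair r hr u
    obtain rfl := Part.mem_unique hs hs'
    obtain ⟨t, ht, -⟩ := hs'' v
    exact Part.dom_iff_mem.2 ⟨t, ht⟩)
  refine h.1.2.1 _ hRUV _ ?_
  rintro t ⟨s, ⟨r, hr, u, hu, hs⟩, v, hv, ht⟩ b x hb
  obtain ⟨s', hs', hs''⟩ := hpair r hr u
  obtain rfl := Part.mem_unique hs hs'
  obtain ⟨t', ht', ht''⟩ := hs'' v
  obtain rfl := Part.mem_unique ht ht'
  obtain ⟨p, hp, hval⟩ := ht'' b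
  obtain ⟨c, hc, hcU⟩ := hu b x hb
  obtain ⟨d, hd, hdV⟩ := hv b x hb
  exact ⟨p, hp, fun k hk => ⟨c, hval k c hc d hd c (hfst k hk c d), hcU⟩,
    fun l hl => ⟨d, hval l c hc d hd d (hsnd l hl c d), hdV⟩⟩

end RealizabilityPaper
end

section
/- Let (A, app) be a partial applicative structure, φ a combinatory complete filter on it, and X a type. There exists a binary operation ⊕ on subsets of A × X such that for all U, V, W ⊆ A × X: U ⊨ U ⊕ V, V ⊨ U ⊕ V, and if U ⊨ W and V ⊨ W then U ⊕ V ⊨ W. That is, the preorder (P(A × X), ⊨) has binary joins. -/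
namespace RealizabilityPaper

variable {A : Type*}

/-- A tracking set of a ternary `φ`-computable map, with the applications spelled out. -/
theorem PhiComputable.exists_ternary_tracker {app : A → A → Part A} {φ : Set (Set A)}
    {f : (Fin 3 → A) → Part A} (hf : PhiComputable app φ f) :
    ∃ R ∈ φ, ∀ r ∈ R, ∀ a b : A, ∃ s ∈ app r a, ∃ t ∈ app s b,
      ∀ c v : A, v ∈ f ![a, b, c] → v ∈ app t c := by
  obtain ⟨R, hR, hdom, hval⟩ := hf
  refine ⟨R, hR, fun r hr a b => ?_⟩
  obtain ⟨t, ht⟩ := Part.dom_iff_mem.1 (hdom r hr ![a, b])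
  simp only [List.ofFn_succ, List.ofFn_zero, iterApp, Part.mem_bind_iff, Part.mem_some_iff] at ht
  obtain ⟨s, hs, t, ht, -⟩ := ht
  refine ⟨s, hs, t, ht, fun c v hv => ?_⟩
  have key := hval r hr _ v hv
  simp only [List.ofFn_succ, List.ofFn_zero, iterApp, Part.mem_bind_iff,
    Part.mem_some_iff] at key
  obtain ⟨s', hs', t', ht', w, hw, rfl⟩ := key
  obtain rfl := Part.mem_unique hs hs'
  obtain rfl := Part.mem_unique ht ht'
  exact hw

/-- The set of values of `u·v` with `u ∈ U`, `v ∈ V`. -/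
def appImage (app : A → A → Part A) (U V : Set A) : Set A :=
  {w | ∃ u ∈ U, ∃ v ∈ V, w ∈ app u v}

/-- The impredicative join: `a` realizes `x` if `a·f·g` realizes `x` in `W` whenever
`f` and `g` map `U` and `V` to `W`. -/
def rjoin (app : A → A → Part A) {X : Type*} (U V : Set (A × X)) : Set (A × X) :=
  {p | ∀ W : Set (A × X), ∀ f ∈ hSet app U W, ∀ g ∈ hSet app V W,
    ∃ s ∈ app p.1 f, ∃ t ∈ app s g, (t, p.2) ∈ W}

section

variable {app : A → A → Part A} {φ : Set (Set A)} {X : Type*}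

theorem rleq_rjoin_left (h : CombComplete app φ) (U V : Set (A × X)) :
    rleq app φ U (rjoin app U V) := by
  obtain ⟨⟨-, hup, -⟩, hproj, happ⟩ := h
  obtain ⟨R, hR, hr⟩ :=
    (happ 3 (by norm_num) _ _ (hproj 3 1) (hproj 3 0)).exists_ternary_tracker
  refine hup R hR _ fun r hrR b x hb => ?_
  obtain ⟨s, hs, -⟩ := hr r hrR b b
  refine ⟨s, hs, fun W f hf g _ => ?_⟩
  obtain ⟨s', hs', t, ht, hval⟩ := hr r hrR b f
  obtain rfl := Part.mem_unique hs hs'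
  obtain ⟨c, hc, hcW⟩ := hf b x hb
  exact ⟨t, ht, c, hval g c (by simpa using hc), hcW⟩

theorem rleq_rjoin_right (h : CombComplete app φ) (U V : Set (A × X)) :
    rleq app φ V (rjoin app U V) := by
  obtain ⟨⟨-, hup, -⟩, hproj, happ⟩ := h
  obtain ⟨R, hR, hr⟩ :=
    (happ 3 (by norm_num) _ _ (hproj 3 2) (hproj 3 0)).exists_ternary_tracker
  refine hup R hR _ fun r hrR b x hb => ?_
  obtain ⟨s, hs, -⟩ := hr r hrR b b
  refine ⟨s, hs, fun W f _ g hg => ?_⟩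
  obtain ⟨s', hs', t, ht, hval⟩ := hr r hrR b f
  obtain rfl := Part.mem_unique hs hs'
  obtain ⟨c, hc, hcW⟩ := hg b x hb
  exact ⟨t, ht, c, hval g c (by simpa using hc), hcW⟩

theorem rjoin_rleq (h : CombComplete app φ) {U V W : Set (A × X)}
    (hU : rleq app φ U W) (hV : rleq app φ V W) : rleq app φ (rjoin app U V) W := by
  obtain ⟨⟨-, hup, himg⟩, hproj, happ⟩ := h
  obtain ⟨R, hR, hr⟩ :=
    (happ 3 (by norm_num) _ _ (happ 3 (by norm_num) _ _ (hproj 3 2) (hproj 3 0))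
      (hproj 3 1)).exists_ternary_tracker
  have hRU : appImage app R (hSet app U W) ∈ φ := himg R hR _ hU fun r hrR f _ =>
    let ⟨s, hs, _⟩ := hr r hrR f f
    Part.dom_iff_mem.2 ⟨s, hs⟩
  have hRUV : appImage app (appImage app R (hSet app U W)) (hSet app V W) ∈ φ := by
    refine himg _ hRU _ hV ?_
    rintro s ⟨r, hrR, f, -, hs⟩ g -
    obtain ⟨s', hs', t, ht, -⟩ := hr r hrR f g
    obtain rfl := Part.mem_unique hs hs'
    exact Part.dom_iff_mem.2 ⟨t, ht⟩
  refine hup _ hRUV _ ?_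
  rintro t ⟨s, ⟨r, hrR, f, hf, hs⟩, g, hg, ht⟩ a x ha
  obtain ⟨s', hs', t', ht', hval⟩ := hr r hrR f g
  obtain rfl := Part.mem_unique hs hs'
  obtain rfl := Part.mem_unique ht ht'
  obtain ⟨u, hu, c, hc, hcW⟩ := ha W f hf g hg
  refine ⟨c, hval a c ?_, hcW⟩
  simpa using ⟨u, hu, hc⟩

end

/-- The preorder `(P(A × X), ⊨)` has binary joins. -/
theorem rleq_has_binary_joins (app : A → A → Part A) (φ : Set (Set A))
    (h : CombComplete app φ) (X : Type*) :
    ∃ jn : Set (A × X) → Set (A × X) → Set (A × X),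
      ∀ U V W : Set (A × X),
        rleq app φ U (jn U V) ∧ rleq app φ V (jn U V) ∧
        (rleq app φ U W → rleq app φ V W → rleq app φ (jn U V) W) := by
  exact ⟨rjoin app, fun U V _ =>
    ⟨rleq_rjoin_left h U V, rleq_rjoin_right h U V, rjoin_rleq h⟩⟩

end RealizabilityPaper
end

section
/- Let (A, app) be a partial applicative structure, φ a combinatory complete filter on it, and X a type. For U, V ⊆ A × X define d(U, V) = {(a, x) ∈ A × X | ∀ b ∈ A, (b, x) ∈ U → a·b is defined and (a·b, x) ∈ V}. Then for all U, V, W ⊆ A × X: U ⊨ d(V, W) if and only if every Z ⊆ A × X with Z ⊨ U and Z ⊨ V satisfies Z ⊨ W. Hence d is a Heyting implication for the preorder (P(A × X), ⊨). -/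
namespace RealizabilityPaper

variable {A : Type*}

/-- Heyting implication `d(U, V)`. -/
def dImp (app : A → A → Part A) {X : Type*} (U V : Set (A × X)) : Set (A × X) :=
  {p | ∀ b : A, (b, p.2) ∈ U → ∃ c ∈ app p.1 b, (c, p.2) ∈ V}

/-- `r` computes the `(n + 1)`-ary partial map `f` in curried form: it may be applied to any
first `n` arguments, and the last application extends `f`. -/
def Tracks (app : A → A → Part A) : (n : ℕ) → A → ((Fin (n + 1) → A) → Part A) → Prop
  | 0, r, f => ∀ a, ∀ v ∈ f (Fin.cons a Fin.elim0), v ∈ app r a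
  | n + 1, r, f => ∀ a, ∃ s ∈ app r a, Tracks app n s fun x => f (Fin.cons a x)

theorem tracks_of_iterApp {app : A → A → Part A} {n : ℕ} {r : A}
    {f : (Fin (n + 1) → A) → Part A}
    (hdom : ∀ x : Fin n → A, (iterApp app r (List.ofFn x)).Dom)
    (hval : ∀ x, ∀ v ∈ f x, v ∈ iterApp app r (List.ofFn x)) : Tracks app n r f := by
  induction n generalizing r with
  | zero =>
    intro a v hv
    simpa [iterApp] using hval _ v hv
  | succ n ih =>
    intro a
    obtain ⟨v, hv⟩ := Part.dom_iff_mem.1 (hdom fun _ => a)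
    rw [List.ofFn_succ, iterApp, Part.mem_bind_iff] at hv
    obtain ⟨s, hs, -⟩ := hv
    have iterApp_cons {m : ℕ} (x : Fin m → A) :
        iterApp app r (List.ofFn (Fin.cons a x : Fin (m + 1) → A)) =
          iterApp app s (List.ofFn x) := by
      simp [List.ofFn_succ, iterApp, Part.eq_some_iff.2 hs]
    refine ⟨s, hs, ih (fun x => ?_) fun x v hv => ?_⟩
    · rw [← iterApp_cons]
      exact hdom _
    · rw [← iterApp_cons]
      exact hval _ v hv

theorem PhiComputable.exists_tracks {app : A → A → Part A} {φ : Set (Set A)} {n : ℕ}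
    {f : (Fin (n + 1) → A) → Part A} (hf : PhiComputable app φ f) :
    ∃ R ∈ φ, ∀ r ∈ R, Tracks app n r f := by
  obtain ⟨R, hR, hdom, hval⟩ := hf
  exact ⟨R, hR, fun r hr => tracks_of_iterApp (hdom r hr) (hval r hr)⟩

theorem IsPasFilter.mem_of_app {app : A → A → Part A} {φ : Set (Set A)}
    (h : IsPasFilter app φ) {R S T : Set A} (hR : R ∈ φ) (hS : S ∈ φ)
    (hT : ∀ r ∈ R, ∀ s ∈ S, ∃ w ∈ app r s, w ∈ T) : T ∈ φ := by
  refine h.2.1 _ (h.2.2 R hR S hS fun r hr s hs => ?_) T ?_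
  · obtain ⟨w, hw, -⟩ := hT r hr s hs
    exact Part.dom_iff_mem.2 ⟨w, hw⟩
  · rintro w ⟨r, hr, s, hs, hw⟩
    obtain ⟨w', hw', hT'⟩ := hT r hr s hs
    rwa [Part.mem_unique hw hw']

/-- The pairs `ρ·u·v` with `ρ ∈ R`, where `u` and `v` realize `U` and `V`. -/
def pairSet (app : A → A → Part A) (R : Set A) {X : Type*} (U V : Set (A × X)) :
    Set (A × X) :=
  {z | ∃ ρ ∈ R, ∃ u v, (u, z.2) ∈ U ∧ (v, z.2) ∈ V ∧ ∃ s ∈ app ρ u, z.1 ∈ app s v}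

theorem CombComplete.pairSet_rleq {app : A → A → Part A} {φ : Set (Set A)}
    (h : CombComplete app φ) {R : Set A}
    (hR : ∀ r ∈ R, Tracks app 2 r fun x =>
      (app (x 2) (x 0)).bind fun a => app a (x 1))
    {X : Type*} {U V Y : Set (A × X)} (i : Fin 2)
    (hY : ∀ u v x, (u, x) ∈ U → (v, x) ∈ V →
      ((Fin.cons u (Fin.cons v Fin.elim0) : Fin 2 → A) i, x) ∈ Y) :
    rleq app φ (pairSet app R U V) Y := by
  obtain ⟨hF, hproj, happ⟩ := h
  obtain ⟨T, hT, hTt⟩ :=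
    (happ 2 (by simp) _ _ (hproj 2 1) (hproj 2 0)).exists_tracks
  obtain ⟨K, hK, hKt⟩ := (hproj 2 i).exists_tracks
  refine hF.mem_of_app hT hK fun t ht k hk => ?_
  obtain ⟨c, hc, hct⟩ := hTt t ht k
  refine ⟨c, hc, ?_⟩
  rintro p x ⟨ρ, hρ, u, v, hu, hv, s, hs, hp⟩
  obtain ⟨s', hs', hst⟩ := hR ρ hρ u
  obtain rfl := Part.mem_unique hs hs'
  obtain ⟨p', hp', hpt⟩ := hst v
  obtain rfl := Part.mem_unique hp hp'
  obtain ⟨q, hq, hqt⟩ := hKt k hk u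
  refine ⟨_, hct p _ ?_, hY u v x hu hv⟩
  refine Part.mem_bind (Part.mem_some p) (Part.mem_bind (Part.mem_some k) ?_)
  refine hpt k _ (Part.mem_bind hq ?_)
  exact hqt v _ (Part.mem_some _)

/-- `d` is a Heyting implication for the preorder `(P(A × X), ⊨)`:
`U ⊨ d(V, W)` iff every `Z` with `Z ⊨ U` and `Z ⊨ V` satisfies `Z ⊨ W`. -/
theorem dImp_heyting (app : A → A → Part A) (φ : Set (Set A))
    (h : CombComplete app φ) {X : Type*} (U V W : Set (A × X)) :
    rleq app φ U (dImp app V W) ↔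
      ∀ Z : Set (A × X), rleq app φ Z U → rleq app φ Z V → rleq app φ Z W := by
  have hc := h
  obtain ⟨hF, hproj, happ⟩ := h
  have h4 : 0 < 4 := by simp
  have hsome {a b c : A} (habc : c ∈ app a b) :
      c ∈ (Part.some a).bind fun a => (Part.some b).bind fun b => app a b := by
    simpa only [Part.bind_some] using habc
  constructor
  · intro hUd Z hZU hZV
    obtain ⟨R, hR, hRt⟩ :=
      (happ 4 h4 _ _ (happ 4 h4 _ _ (hproj 4 0) (happ 4 h4 _ _ (hproj 4 1) (hproj 4 3)))
        (happ 4 h4 _ _ (hproj 4 2) (hproj 4 3))).exists_tracks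
    refine hF.mem_of_app (hF.mem_of_app (hF.mem_of_app
      (T := {a | ∀ s ∈ hSet app Z U, ∃ b ∈ app a s,
        b ∈ {b | ∀ t ∈ hSet app Z V, ∃ c ∈ app b t, c ∈ hSet app Z W}}) hR hUd ?_)
      hZU fun a ha => ha) hZV fun b hb => hb
    intro ρ hρ r hr
    obtain ⟨a, ha, hat⟩ := hRt ρ hρ r
    refine ⟨a, ha, fun s hs => ?_⟩
    obtain ⟨b, hb, hbt⟩ := hat s
    refine ⟨b, hb, fun t ht => ?_⟩
    obtain ⟨c, hc, hct⟩ := hbt t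
    refine ⟨c, hc, fun z x hz => ?_⟩
    obtain ⟨u, hu, huU⟩ := hs z x hz
    obtain ⟨v, hv, hvV⟩ := ht z x hz
    obtain ⟨d, hd, hdV⟩ := hr u x huU
    obtain ⟨w, hw, hwW⟩ := hdV v hvV
    refine ⟨w, hct z w ?_, hwW⟩
    exact Part.mem_bind (Part.mem_bind (Part.mem_some r) (Part.mem_bind (hsome hu) hd))
      (Part.mem_bind (hsome hv) hw)
  · intro hZ
    obtain ⟨R, hR, hRt⟩ :=
      (happ 3 (by simp) _ _ (happ 3 (by simp) _ _ (hproj 3 2) (hproj 3 0))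
        (hproj 3 1)).exists_tracks
    simp only [Part.bind_some] at hRt
    obtain ⟨T, hT, hTt⟩ :=
      (happ 4 h4 _ _ (hproj 4 1) (happ 4 h4 _ _ (happ 4 h4 _ _ (hproj 4 0) (hproj 4 2))
        (hproj 4 3))).exists_tracks
    have hZW := hZ (pairSet app R U V)
      (hc.pairSet_rleq hRt 0 fun u v x hu _ => hu)
      (hc.pairSet_rleq hRt 1 fun u v x _ hv => hv)
    refine hF.mem_of_app (hF.mem_of_app
      (T := {b | ∀ a ∈ hSet app (pairSet app R U V) W, ∃ c ∈ app b a,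
        c ∈ hSet app U (dImp app V W)}) hT hR ?_) hZW fun b hb => hb
    intro t ht ρ hρ
    obtain ⟨b, hb, hbt⟩ := hTt t ht ρ
    refine ⟨b, hb, fun a ha => ?_⟩
    obtain ⟨c, hc, hct⟩ := hbt a
    refine ⟨c, hc, fun u x hu => ?_⟩
    obtain ⟨d, hd, hdt⟩ := hct u
    refine ⟨d, hd, fun v hv => ?_⟩
    obtain ⟨s, hs, hst⟩ := hRt ρ hρ u
    obtain ⟨p, hp, -⟩ := hst v
    obtain ⟨w, hw, hwW⟩ := ha p x ⟨ρ, hρ, u, v, hu, hv, s, hs, hp⟩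
    refine ⟨w, hdt v w ?_, hwW⟩
    exact Part.mem_bind (Part.mem_some a)
      (Part.mem_bind (Part.mem_bind (hsome hs) (Part.mem_bind (Part.mem_some v) hp)) hw)

end RealizabilityPaper
end

section
/- Let (A, app) be a partial applicative structure and φ a combinatory complete filter on it. For every subset I ⊆ A: I ∈ φ if and only if there exists R ∈ φ such that for all r ∈ R and all a ∈ A, r·a is defined and r·a ∈ I. -/
namespace RealizabilityPaper

variable {A : Type*}

/-- `I ∈ φ` iff there is `R ∈ φ` all of whose elements send every `a : A`
to an element of `I` (the set-theoretic form of: `∇I ∩ Å` is inhabited iff `I ∈ φ`). -/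
theorem mem_filter_iff_realized (app : A → A → Part A) (φ : Set (Set A))
    (h : CombComplete app φ) (I : Set A) :
    I ∈ φ ↔ ∃ R ∈ φ, ∀ r ∈ R, ∀ a : A, ∃ c ∈ app r a, c ∈ I := by
  obtain ⟨⟨-, hup, happ⟩, hproj, -⟩ := h
  obtain ⟨K, hK, hKdom, hKval⟩ := hproj 2 0
  constructor
  · intro hI
    refine ⟨_, happ K hK I hI fun k hk i _ => ?_, ?_⟩
    · have hdom := hKdom k hk ![i]
      simpa [iterApp] using hdom
    · rintro r ⟨k, hk, i, hi, hr⟩ a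
      have hval := hKval k hk ![i, a] i (by simp)
      simp only [List.ofFn_succ, List.ofFn_zero, iterApp, Part.mem_bind_iff] at hval
      obtain ⟨s, hs, c, hc, hic⟩ := hval
      obtain rfl := Part.mem_unique hr hs
      obtain rfl := Part.mem_some_iff.mp hic
      exact ⟨_, hc, hi⟩
  · rintro ⟨R, hR, hRI⟩
    refine hup _ (happ R hR K hK fun r hr k _ => ?_) I ?_
    · obtain ⟨c, hc, -⟩ := hRI r hr k
      exact Part.dom_iff_mem.mpr ⟨c, hc⟩
    · rintro w ⟨r, hr, k, -, hw⟩
      obtain ⟨c, hc, hcI⟩ := hRI r hr k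
      exact Part.mem_unique hw hc ▸ hcI

end RealizabilityPaper
end

section
/- Let C and B be categories, U : C ⥤ B and F : B ⥤ C functors, and adj : U ⊣ F an adjunction with unit η : 𝟭_C ⟶ U ⋙ F and counit ε : F ⋙ U ⟶ 𝟭_B. Assume each component of ε is an isomorphism and each component of η is a monomorphism. Then a morphism p : X ⟶ Y in C is prone if and only if the naturality square of η at p (with sides p : X ⟶ Y, η_X : X ⟶ F(U X), η_Y : Y ⟶ F(U Y), and F(U p) : F(U X) ⟶ F(U Y)) is a pullback square. -/
namespace RealizabilityPaper

open CategoryTheory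

/-- A morphism `p : X ⟶ Y` is prone (Cartesian) for `U : C ⥤ B`: for every
`f : Z ⟶ Y` and `g : U Z ⟶ U X` with `g ≫ U p = U f` there is a unique
`h : Z ⟶ X` with `h ≫ p = f` and `U h = g`. -/
def Prone {C B : Type*} [Category C] [Category B] (U : C ⥤ B)
    {X Y : C} (p : X ⟶ Y) : Prop :=
  ∀ (Z : C) (f : Z ⟶ Y) (g : U.obj Z ⟶ U.obj X),
    g ≫ U.map p = U.map f → ∃! h : Z ⟶ X, h ≫ p = f ∧ U.map h = g

open Limits

theorem comp_unit_eq_homEquiv_map {C B : Type*} [Category C] [Category B]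
    {U : C ⥤ B} {F : B ⥤ C} (adj : U ⊣ F) {Z X : C} (h : Z ⟶ X) :
    h ≫ adj.unit.app X = adj.homEquiv Z (U.obj X) (U.map h) := by
  rw [adj.homEquiv_unit, adj.unit_naturality]

/-- If `U ⊣ F` with invertible counit and monic unit `η`, then `p` is prone for `U`
iff the naturality square of `η` at `p` is a pullback. -/
theorem prone_iff_isPullback {C B : Type*} [Category C] [Category B]
    (U : C ⥤ B) (F : B ⥤ C) (adj : U ⊣ F)
    (hcounit : ∀ b : B, IsIso (adj.counit.app b))
    (hunit : ∀ c : C, Mono (adj.unit.app c))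
    {X Y : C} (p : X ⟶ Y) :
    Prone U p ↔
      IsPullback p (adj.unit.app X) (adj.unit.app Y) (F.map (U.map p)) := by
  constructor
  · intro hp
    have key : ∀ s : PullbackCone (adj.unit.app Y) (F.map (U.map p)),
        ∃! h : s.pt ⟶ X, h ≫ p = s.fst ∧ h ≫ adj.unit.app X = s.snd := by
      intro s
      have hs : (adj.homEquiv _ _).symm s.snd ≫ U.map p = U.map s.fst := by
        rw [← adj.homEquiv_naturality_right_symm, ← s.condition,
          Equiv.symm_apply_eq]
        exact comp_unit_eq_homEquiv_map adj s.fst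
      simpa only [comp_unit_eq_homEquiv_map adj, Equiv.eq_symm_apply] using
        hp s.pt s.fst _ hs
    choose lift hlift huniq using key
    exact ⟨⟨(adj.unit_naturality p).symm⟩,
      ⟨PullbackCone.IsLimit.mk _ lift (fun s => (hlift s).1) (fun s => (hlift s).2)
        fun s m h₁ h₂ => huniq s m ⟨h₁, h₂⟩⟩⟩
  · intro hp Z f g hg
    have hw : f ≫ adj.unit.app Y = adj.homEquiv _ _ g ≫ F.map (U.map p) := by
      rw [comp_unit_eq_homEquiv_map adj, ← hg, adj.homEquiv_naturality_right]
    refine ⟨hp.lift f _ hw, ⟨hp.lift_fst _ _ _, ?_⟩, ?_⟩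
    · apply (adj.homEquiv _ _).injective
      rw [← comp_unit_eq_homEquiv_map adj, hp.lift_snd]
    · rintro h ⟨h₁, h₂⟩
      apply hp.hom_ext
      · rw [h₁, hp.lift_fst]
      · rw [hp.lift_snd, comp_unit_eq_homEquiv_map adj, h₂]

end RealizabilityPaper
end

section
/- Let (A, app) be a partial applicative structure and let (φᵢ)_{i ∈ ι} be a nonempty family of filters on (A, app). Then the intersection ⋂ᵢ φᵢ is a filter on (A, app). Moreover, if every φᵢ is combinatory complete, then ⋂ᵢ φᵢ is combinatory complete. -/
namespace RealizabilityPaper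

variable {A : Type*}

/-- A partial map is computable for every member of a family of filters iff it is computable
for the intersection: upward closure allows taking the set of all realizers. -/
theorem phiComputable_iInter_iff {ι : Type*} {app : A → A → Part A}
    {φ : ι → Set (Set A)} (h : ∀ i, IsPasFilter app (φ i)) {n : ℕ}
    {f : (Fin n → A) → Part A} :
    PhiComputable app (⋂ i, φ i) f ↔ ∀ i, PhiComputable app (φ i) f := by
  constructor
  · rintro ⟨R, hR, hf⟩ i
    exact ⟨R, Set.mem_iInter.1 hR i, hf⟩
  · intro hf
    refine ⟨{r | (∀ x : Fin (n - 1) → A, (iterApp app r (List.ofFn x)).Dom) ∧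
      ∀ x : Fin n → A, ∀ v ∈ f x, v ∈ iterApp app r (List.ofFn x)},
      Set.mem_iInter.2 fun i => ?_, fun r hr => hr.1, fun r hr => hr.2⟩
    obtain ⟨R, hR, hdom, hval⟩ := hf i
    exact (h i).2.1 R hR _ fun r hr => ⟨hdom r hr, hval r hr⟩

/-- The intersection of a nonempty family of filters is a filter. -/
theorem IsPasFilter.iInter {ι : Type*} [Nonempty ι] {app : A → A → Part A}
    {φ : ι → Set (Set A)} (h : ∀ i, IsPasFilter app (φ i)) :
    IsPasFilter app (⋂ i, φ i) := by
  simp only [IsPasFilter, Set.mem_iInter]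
  refine ⟨fun U hU => ?_, fun U hU V hUV i => (h i).2.1 U (hU i) V hUV,
    fun U hU V hV hdom i => (h i).2.2 U (hU i) V (hV i) hdom⟩
  obtain ⟨i⟩ := ‹Nonempty ι›
  exact (h i).1 U (hU i)

/-- The intersection of a nonempty family of filters is a filter, and the intersection
of a nonempty family of combinatory complete filters is combinatory complete. -/
theorem iInter_isPasFilter_and_combComplete {ι : Type*} [Nonempty ι]
    (app : A → A → Part A) (φ : ι → Set (Set A))
    (h : ∀ i, IsPasFilter app (φ i)) :
    IsPasFilter app (⋂ i, φ i) ∧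
    ((∀ i, CombComplete app (φ i)) → CombComplete app (⋂ i, φ i)) := by
  refine ⟨.iInter h, fun hc => ⟨.iInter h, fun n j => ?_, fun n hn f g hf hg => ?_⟩⟩
  · exact (phiComputable_iInter_iff h).2 fun i => (hc i).2.1 n j
  · rw [phiComputable_iInter_iff h] at hf hg ⊢
    exact fun i => (hc i).2.2 n hn f g (hf i) (hg i)

end RealizabilityPaper
end
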